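/- Let n ≥ 2 and let K₁ ⊆ K₂ be nonempty compact convex subsets of ℝⁿ. Let x : [a,b] → ℝⁿ be a self-expanding curve forming an expanding couple with the stratification {K₁, K₂}, i.e.: the image of x is contained in K₂; x meets K₁; x meets the relative boundary of K₂; and for each Q ∈ {K₁, K₂}, every y ∈ Q and all s ≤ s' in [a,b], if x(s) ∉ relint Q then |x(s) − y| ≤ |x(s') − y|. Then: (i) the variation of x on {t ∈ [a,b] : x(t) ∉ K₁} is at most 2·c_n·dist(K₁, K₂), where c_n is a constant depending only on n and dist is the Hausdorff distance; (ii) there is a constant c depending only on n and on diam(K₂) such that this variation is at most c·(w(K₂) − w(K₁))^{1/n}. -/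

import Mathlib

open Set Metric MeasureTheory
open scoped RealInnerProductSpace

noncomputable section

/-- Support function of a set. -/
def suppFn {n : ℕ} (C : Set (EuclideanSpace ℝ (Fin n))) (x : EuclideanSpace ℝ (Fin n)) : ℝ :=
  sSup ((fun y => ⟪x, y⟫) '' C)

/-- Normal cone of a set `C` at `q`. -/
def normalCone {n : ℕ} (C : Set (EuclideanSpace ℝ (Fin n))) (q : EuclideanSpace ℝ (Fin n)) :
    Set (EuclideanSpace ℝ (Fin n)) :=
  {v | ∀ y ∈ C, ⟪v, y - q⟫ ≤ 0}

/-- Tangent (support) cone of `C` at `q`. -/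
def supportCone {n : ℕ} (C : Set (EuclideanSpace ℝ (Fin n))) (q : EuclideanSpace ℝ (Fin n)) :
    Set (EuclideanSpace ℝ (Fin n)) :=
  closure {v | ∃ s : ℝ, 0 ≤ s ∧ ∃ y ∈ C, v = s • (y - q)}

/-- Cap body: convex hull of `K ∪ {p}`. -/
def capBody {n : ℕ} (K : Set (EuclideanSpace ℝ (Fin n))) (p : EuclideanSpace ℝ (Fin n)) :
    Set (EuclideanSpace ℝ (Fin n)) :=
  convexHull ℝ (K ∪ {p})

/-- Spherical Lebesgue (surface) measure on `ℝⁿ`: the `(n-1)`-dimensional Hausdorff measure. -/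
def sphereMeasure (n : ℕ) : Measure (EuclideanSpace ℝ (Fin n)) := μH[(n : ℝ) - 1]

/-- Total surface measure of the unit sphere in `ℝⁿ`. -/
def sphereArea (n : ℕ) : ℝ :=
  (sphereMeasure n (sphere (0 : EuclideanSpace ℝ (Fin n)) 1)).toReal

/-- Mean width of a set `C ⊆ ℝⁿ`. -/
def meanWidth {n : ℕ} (C : Set (EuclideanSpace ℝ (Fin n))) : ℝ :=
  (2 / sphereArea n) * ∫ θ in sphere (0 : EuclideanSpace ℝ (Fin n)) 1, suppFn C θ ∂(sphereMeasure n)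

/-- Self expanding curve on `[a,b]`. -/
def SelfExpanding {n : ℕ} (a b : ℝ) (x : ℝ → EuclideanSpace ℝ (Fin n)) : Prop :=
  ContinuousOn x (Icc a b) ∧
  ∀ t₁ t₂ t₃, a ≤ t₁ → t₁ ≤ t₂ → t₂ ≤ t₃ → t₃ ≤ b → dist (x t₂) (x t₁) ≤ dist (x t₃) (x t₁)

/-- Quasi convex family on `[a,b]`. -/
def QuasiConvexFamily {n : ℕ} (a b : ℝ) (Ω : ℝ → Set (EuclideanSpace ℝ (Fin n))) : Prop :=
  (∀ t ∈ Icc a b, (Ω t).Nonempty ∧ IsCompact (Ω t) ∧ Convex ℝ (Ω t)) ∧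
  (∀ s t, a ≤ s → s < t → t ≤ b → Ω s ⊂ Ω t) ∧
  (∀ s ∈ Ico a b, ⋂ t ∈ Ioc s b, Ω t = Ω s)

/-- Connectedness of a quasi convex family. -/
def ConnectedFamily {n : ℕ} (a b : ℝ) (Ω : ℝ → Set (EuclideanSpace ℝ (Fin n))) : Prop :=
  ∀ x ∈ Ω b \ intrinsicInterior ℝ (Ω a), ∃ t ∈ Icc a b, x ∈ intrinsicFrontier ℝ (Ω t)


/-- A finite set of vectors meeting (quantitatively) the dual cone of every family of unit vectors
with pairwise nonnegative inner products. -/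
lemma exists_directions {E : Type*} [NormedAddCommGroup E] [InnerProductSpace ℝ E]
    [FiniteDimensional ℝ E] :
    ∃ V : Finset E, ∀ S : Set E, (∀ w ∈ S, ‖w‖ = 1) →
      (∀ w ∈ S, ∀ w' ∈ S, 0 ≤ ⟪w, w'⟫) → ∃ v ∈ V, ∀ w ∈ S, 1 / 4 ≤ ⟪v, w⟫ := by
  classical
  have : ProperSpace E := FiniteDimensional.proper ℝ E
  obtain ⟨T, -, hTfin, hT⟩ := (isCompact_sphere (0 : E) 1).finite_cover_balls
    (show (0 : ℝ) < 1 / 2 by norm_num)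
  obtain ⟨V, -, hVfin, hV⟩ :=
    (isCompact_closedBall (0 : E) (hTfin.toFinset.card : ℝ)).finite_cover_balls
    (show (0 : ℝ) < 1 / 4 by norm_num)
  refine ⟨hVfin.toFinset, fun S hS1 hS2 => ?_⟩
  let g : E → E := fun t => if h : ∃ w ∈ S, dist w t < 1 / 2 then h.choose else 0
  have hg : ∀ t, g t = 0 ∨ (g t ∈ S ∧ dist (g t) t < 1 / 2) := by
    intro t
    by_cases h : ∃ w ∈ S, dist w t < 1 / 2
    · right
      simp only [g, dif_pos h]
      exact h.choose_spec
    · left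
      simp only [g, dif_neg h]
  have hg' : ∀ t, (∃ w ∈ S, dist w t < 1 / 2) → (g t ∈ S ∧ dist (g t) t < 1 / 2) := by
    intro t h
    simp only [g, dif_pos h]
    exact h.choose_spec
  have hgn : ∀ t, ‖g t‖ ≤ 1 := by
    intro t
    rcases hg t with h | h
    · simp [h]
    · exact (hS1 _ h.1).le
  set z : E := ∑ t ∈ hTfin.toFinset, g t with hz
  have hzn : ‖z‖ ≤ (hTfin.toFinset.card : ℝ) := by
    calc ‖z‖ ≤ ∑ t ∈ hTfin.toFinset, ‖g t‖ := norm_sum_le _ _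
      _ ≤ ∑ t ∈ hTfin.toFinset, (1 : ℝ) := Finset.sum_le_sum fun t _ => hgn t
      _ = _ := by simp
  have hzS : ∀ w ∈ S, 1 / 2 ≤ ⟪z, w⟫ := by
    intro w hw
    have hw1 : w ∈ sphere (0 : E) 1 := by simp [hS1 w hw]
    obtain ⟨t, htT, htw⟩ := mem_iUnion₂.1 (hT hw1)
    obtain ⟨h1, h2⟩ := hg' t ⟨w, hw, htw⟩
    have hnn : ∀ s ∈ hTfin.toFinset, 0 ≤ ⟪g s, w⟫ := by
      intro s _
      rcases hg s with h | h
      · simp [h]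
      · exact hS2 _ h.1 _ hw
    have h3 : ⟪g t, w⟫ ≤ ⟪z, w⟫ := by
      rw [hz, sum_inner]
      exact Finset.single_le_sum hnn (hTfin.mem_toFinset.2 htT)
    have h4 : ‖g t - w‖ ≤ 1 := by
      rw [← dist_eq_norm]
      have := dist_triangle_right (g t) w t
      have h5 : dist w t < 1 / 2 := htw
      linarith
    have h6 := norm_sub_sq_real (g t) w
    rw [hS1 _ h1, hS1 _ hw] at h6
    have h7 : ‖g t - w‖ ^ 2 ≤ 1 := by
      have := norm_nonneg (g t - w)
      nlinarith
    linarith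
  obtain ⟨v, hvV, hvz⟩ := mem_iUnion₂.1 (hV (show z ∈ closedBall (0 : E) _ by simpa using hzn))
  refine ⟨v, hVfin.mem_toFinset.2 hvV, fun w hw => ?_⟩
  have h1 : ⟪z - v, w⟫ ≤ ‖z - v‖ * ‖w‖ := real_inner_le_norm _ _
  have h2 : ‖z - v‖ < 1 / 4 := by rw [← dist_eq_norm]; exact hvz
  rw [hS1 w hw, inner_sub_left] at h1
  have := hzS w hw
  linarith

/-- Finite self-expanding polygons have length controlled by their diameter. -/
lemma seq_length_bound (E : Type*) [NormedAddCommGroup E] [InnerProductSpace ℝ E]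
    [FiniteDimensional ℝ E] :
    ∃ C : ℝ, 0 < C ∧ ∀ (y : ℕ → E) (d : ℝ) (N : ℕ),
      (∀ i j k, i ≤ j → j ≤ k → dist (y j) (y i) ≤ dist (y k) (y i)) →
      (∀ i j, dist (y i) (y j) ≤ d) →
      ∑ i ∈ Finset.range N, dist (y (i + 1)) (y i) ≤ C * d := by
  classical
  obtain ⟨V, hV⟩ := exists_directions (E := E)
  refine ⟨8 * (∑ v ∈ V, ‖v‖) + 1, by positivity, fun y d N hy hd => ?_⟩
  have hd0 : 0 ≤ d := dist_nonneg.trans (hd 0 0)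
  let M : E → ℕ → ℝ := fun v => partialSups (fun i => -⟪v, y i⟫)
  have hMmono : ∀ v k, M v k ≤ M v (k + 1) := fun v k =>
    partialSups_monotone _ (Nat.le_succ k)
  have hstep : ∀ k, ∃ v ∈ V, dist (y (k + 1)) (y k) ≤ 8 * (M v (k + 1) - M v k) := by
    intro k
    by_cases hpq : y (k + 1) = y k
    · obtain ⟨v, hv, -⟩ := hV ∅ (by simp) (by simp)
      refine ⟨v, hv, ?_⟩
      have := hMmono v k
      rw [hpq, dist_self]
      linarith
    set q := y (k + 1) with hq
    -- every past point is away from the new one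
    have hfar : ∀ i ≤ k, dist q (y k) ≤ 2 * ‖y i - q‖ := by
      intro i hi
      have h1 := hy i k (k + 1) hi (Nat.le_succ k)
      have h2 := dist_triangle q (y i) (y k)
      rw [← dist_eq_norm, dist_comm (y i) q]
      rw [dist_comm (y i) (y k)] at h2
      linarith
    have hpos : 0 < dist q (y k) := dist_pos.2 hpq
    have hnpos : ∀ i ≤ k, 0 < ‖y i - q‖ := fun i hi => by
      have := hfar i hi
      linarith
    have hang' : ∀ i j, i ≤ j → j ≤ k → 0 ≤ ⟪y i - q, y j - q⟫ := by
      intro i j hij hjk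
      have h1 := hy i j (k + 1) hij (hjk.trans (Nat.le_succ k))
      rw [← hq, dist_eq_norm, dist_eq_norm, norm_sub_rev q] at h1
      have h2 := norm_sub_sq_real (y j - q) (y i - q)
      rw [sub_sub_sub_cancel_right, real_inner_comm] at h2
      have h3 : ‖y j - y i‖ ^ 2 ≤ ‖y i - q‖ ^ 2 := by gcongr
      nlinarith [sq_nonneg ‖y j - q‖]
    have hang : ∀ i j, i ≤ k → j ≤ k → 0 ≤ ⟪y i - q, y j - q⟫ := by
      intro i j hi hj
      rcases le_total i j with h | h
      · exact hang' i j h hj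
      · rw [real_inner_comm]; exact hang' j i h hi
    obtain ⟨v, hvV, hv⟩ := hV {w | ∃ i ≤ k, w = (‖y i - q‖)⁻¹ • (y i - q)}
      (by
        rintro w ⟨i, hi, rfl⟩
        rw [norm_smul, norm_inv, norm_norm, inv_mul_cancel₀ (hnpos i hi).ne'])
      (by
        rintro w ⟨i, hi, rfl⟩ w' ⟨j, hj, rfl⟩
        rw [real_inner_smul_left, real_inner_smul_right]
        have := hang i j hi hj
        positivity)
    refine ⟨v, hvV, ?_⟩
    have h1 : M v k ≤ -⟪v, q⟫ - dist q (y k) / 8 := by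
      refine partialSups_le _ _ _ fun i hi => ?_
      have h2 := hv _ ⟨i, hi, rfl⟩
      rw [real_inner_smul_right, inv_mul_eq_div, le_div_iff₀ (hnpos i hi), inner_sub_right] at h2
      have := hfar i hi
      linarith
    have h2 : -⟪v, q⟫ ≤ M v (k + 1) := le_partialSups (fun i => -⟪v, y i⟫) (k + 1)
    linarith
  have hstep' : ∀ k, dist (y (k + 1)) (y k) ≤ ∑ v ∈ V, 8 * (M v (k + 1) - M v k) := by
    intro k
    obtain ⟨v, hv, h⟩ := hstep k
    refine h.trans (Finset.single_le_sum (f := fun v => 8 * (M v (k + 1) - M v k)) ?_ hv)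
    intro w _
    have := hMmono w k
    linarith
  have htot : ∀ v, M v N - M v 0 ≤ ‖v‖ * d := by
    intro v
    have : M v N ≤ M v 0 + ‖v‖ * d := by
      refine partialSups_le _ _ _ fun i _ => ?_
      have h0 : M v 0 = -⟪v, y 0⟫ := by simp [M]
      have h1 : ⟪v, y 0 - y i⟫ ≤ ‖v‖ * ‖y 0 - y i‖ := real_inner_le_norm _ _
      have h2 : ‖y 0 - y i‖ ≤ d := by rw [← dist_eq_norm]; exact hd _ _
      have h3 := mul_le_mul_of_nonneg_left h2 (norm_nonneg v)
      rw [inner_sub_right] at h1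
      rw [h0]
      linarith
    linarith
  calc ∑ i ∈ Finset.range N, dist (y (i + 1)) (y i)
      ≤ ∑ i ∈ Finset.range N, ∑ v ∈ V, 8 * (M v (i + 1) - M v i) :=
        Finset.sum_le_sum fun i _ => hstep' i
    _ = ∑ v ∈ V, 8 * (M v N - M v 0) := by
        rw [Finset.sum_comm]
        refine Finset.sum_congr rfl fun v _ => ?_
        rw [← Finset.mul_sum, Finset.sum_range_sub]
    _ ≤ ∑ v ∈ V, 8 * (‖v‖ * d) := Finset.sum_le_sum fun v _ => by
        have := htot v
        linarith
    _ = 8 * (∑ v ∈ V, ‖v‖) * d := by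
        rw [mul_assoc, Finset.sum_mul, Finset.mul_sum]
    _ ≤ _ := by nlinarith

lemma variation_bound (E : Type*) [NormedAddCommGroup E] [InnerProductSpace ℝ E]
    [FiniteDimensional ℝ E] :
    ∃ C : ℝ, 0 < C ∧ ∀ (x : ℝ → E) (S : Set ℝ) (d : ℝ),
      (∀ t₁ ∈ S, ∀ t₂ ∈ S, ∀ t₃ ∈ S, t₁ ≤ t₂ → t₂ ≤ t₃ →
        dist (x t₂) (x t₁) ≤ dist (x t₃) (x t₁)) →
      (∀ t ∈ S, ∀ t' ∈ S, dist (x t) (x t') ≤ d) →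
      eVariationOn x S ≤ ENNReal.ofReal (C * d) := by
  obtain ⟨C, hC, h⟩ := seq_length_bound E
  refine ⟨C, hC, fun x S d hx hd => ?_⟩
  refine iSup_le ?_
  rintro ⟨N, u, hu, huS⟩
  have := h (fun i => x (u i)) d N
    (fun i j k hij hjk => hx _ (huS i) _ (huS j) _ (huS k) (hu hij) (hu hjk))
    (fun i j => hd _ (huS i) _ (huS j))
  refine le_trans (le_of_eq ?_) (ENNReal.ofReal_le_ofReal this)
  rw [ENNReal.ofReal_sum_of_nonneg (fun _ _ => dist_nonneg)]
  simp [edist_dist]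

lemma couple_variation (E : Type*) [NormedAddCommGroup E] [InnerProductSpace ℝ E]
    [FiniteDimensional ℝ E] :
    ∃ C : ℝ, 0 < C ∧ ∀ (K₁ : Set E) (a b h : ℝ) (x : ℝ → E),
      K₁.Nonempty → IsCompact K₁ →
      (∀ t₁ t₂ t₃, a ≤ t₁ → t₁ ≤ t₂ → t₂ ≤ t₃ → t₃ ≤ b →
        dist (x t₂) (x t₁) ≤ dist (x t₃) (x t₁)) →
      (∀ y ∈ K₁, ∀ s s', a ≤ s → s ≤ s' → s' ≤ b → x s ∉ intrinsicInterior ℝ K₁ →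
            dist (x s) y ≤ dist (x s') y) →
      (∀ t ∈ Icc a b, infDist (x t) K₁ ≤ h) →
      eVariationOn x {t | t ∈ Icc a b ∧ x t ∉ K₁} ≤ ENNReal.ofReal (2 * C * h) := by
  obtain ⟨C, hC, hvar⟩ := variation_bound E
  refine ⟨C, hC, fun K₁ a b h x hne hK hx hK₁ hh => ?_⟩
  have key : ∀ t t', t ∈ Icc a b → x t ∉ K₁ → t' ∈ Icc a b → t ≤ t' →
      dist (x t) (x t') ≤ 2 * h := by
    intro t t' ht htK ht' htt
    obtain ⟨p, hp, hpd⟩ := hK.exists_infDist_eq_dist hne (x t')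
    have h1 := hK₁ p hp t t' ht.1 htt ht'.2 (fun hc => htK (intrinsicInterior_subset hc))
    have h2 := hh t' ht'
    have h3 := dist_triangle_right (x t) (x t') p
    linarith
  have := hvar x {t | t ∈ Icc a b ∧ x t ∉ K₁} (2 * h)
    (fun t₁ h₁ t₂ _ t₃ h₃ h12 h23 => hx t₁ t₂ t₃ h₁.1.1 h12 h23 h₃.1.2)
    (by
      rintro t ⟨ht, htK⟩ t' ⟨ht', htK'⟩
      rcases le_total t t' with h | h
      · exact key t t' ht htK ht' h
      · rw [dist_comm]; exact key t' t ht' htK' ht h)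
  convert this using 2
  ring

lemma cap_measure {m : ℕ} (u : EuclideanSpace ℝ (Fin (m + 1))) (hu : ‖u‖ = 1) (r : ℝ)
    (hr0 : 0 < r) (hr1 : r ≤ 1) :
    ENNReal.ofReal ((r / (m + 1)) ^ m) ≤
      μH[(m : ℝ)] (sphere (0 : EuclideanSpace ℝ (Fin (m + 1))) 1 ∩ closedBall u r) := by
  have hu0 : u ≠ 0 := by rintro rfl; simp at hu
  have : Fact (Module.finrank ℝ (EuclideanSpace ℝ (Fin (m + 1))) = m + 1) := ⟨by simp⟩
  let b := OrthonormalBasis.fromOrthogonalSpanSingleton (𝕜 := ℝ) m hu0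
  let F : EuclideanSpace ℝ (Fin (m + 1)) → (Fin m → ℝ) := fun θ j => ⟪(b j : EuclideanSpace ℝ (Fin (m + 1))), θ⟫
  have hbn : ∀ j, ‖(b j : EuclideanSpace ℝ (Fin (m + 1)))‖ = 1 := fun j => b.norm_eq_one j
  have hF : LipschitzWith 1 F := by
    refine LipschitzWith.of_dist_le_mul fun x y => ?_
    rw [NNReal.coe_one, one_mul, dist_pi_le_iff dist_nonneg]
    intro j
    rw [Real.dist_eq, ← inner_sub_right, dist_eq_norm]
    refine (abs_real_inner_le_norm _ _).trans ?_
    rw [hbn, one_mul]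
  set ρ : ℝ := r / (2 * (m + 1)) with hρ
  have hρ0 : 0 < ρ := by positivity
  have hsub : Icc (fun _ : Fin m => -ρ) (fun _ => ρ) ⊆
      F '' (sphere (0 : EuclideanSpace ℝ (Fin (m + 1))) 1 ∩ closedBall u r) := by
    intro z hz
    let w' : (Submodule.span ℝ {u})ᗮ := ∑ j, z j • b j
    let w : EuclideanSpace ℝ (Fin (m + 1)) := w'
    have hwz : ∀ j, ⟪(b j : EuclideanSpace ℝ (Fin (m + 1))), w⟫ = z j := by
      intro j
      have : ⟪b j, w'⟫ = z j := b.orthonormal.inner_right_fintype z j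
      exact this
    have hbu : ∀ v : (Submodule.span ℝ {u})ᗮ, ⟪(v : EuclideanSpace ℝ (Fin (m + 1))), u⟫ = 0 := by
      intro v
      rw [real_inner_comm]
      exact Submodule.mem_orthogonal_singleton_iff_inner_right.1 v.2
    have hwn : ‖w‖ ^ 2 = ∑ j, z j ^ 2 := by
      have h1 : ‖w'‖ ^ 2 = ∑ j, ‖⟪b j, w'⟫‖ ^ 2 := (b.sum_sq_norm_inner_right w').symm
      have h2 : ‖w‖ = ‖w'‖ := rfl
      rw [h2, h1]
      refine Finset.sum_congr rfl fun j _ => ?_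
      have : ⟪b j, w'⟫ = z j := b.orthonormal.inner_right_fintype z j
      rw [this, Real.norm_eq_abs, sq_abs]
    have hws : ‖w‖ ^ 2 ≤ r ^ 2 / 2 := by
      rw [hwn]
      have h1 : ∑ j, z j ^ 2 ≤ ∑ j : Fin m, ρ ^ 2 := Finset.sum_le_sum fun j _ => by
        have h1 : -ρ ≤ z j := hz.1 j
        have h2 : z j ≤ ρ := hz.2 j
        nlinarith
      refine h1.trans ?_
      simp only [Finset.sum_const, Finset.card_univ, Fintype.card_fin, nsmul_eq_mul]
      have h3 : r = ρ * (2 * (m + 1)) := by rw [hρ]; field_simp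
      have hm : (0 : ℝ) ≤ m := Nat.cast_nonneg m
      rw [h3]
      have := sq_nonneg ρ
      nlinarith [mul_nonneg hm this, mul_nonneg (mul_nonneg hm hm) this]
    have hw1 : ‖w‖ ^ 2 ≤ 1 := by nlinarith
    set c := Real.sqrt (1 - ‖w‖ ^ 2) with hc
    have hc2 : c ^ 2 = 1 - ‖w‖ ^ 2 := Real.sq_sqrt (by linarith)
    have hc0 : 0 ≤ c := Real.sqrt_nonneg _
    have hc1 : c ≤ 1 := by nlinarith [sq_nonneg ‖w‖]
    refine ⟨w + c • u, ⟨?_, ?_⟩, ?_⟩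
    · have : ‖w + c • u‖ ^ 2 = 1 := by
        rw [norm_add_sq_real, real_inner_smul_right, hbu w', norm_smul, hu, Real.norm_eq_abs,
          mul_one, sq_abs, hc2]
        ring
      rw [mem_sphere_zero_iff_norm]
      exact (pow_eq_one_iff_of_nonneg (norm_nonneg _) two_ne_zero).1 this
    · have e : w + c • u - u = w + (c - 1) • u := by rw [sub_smul, one_smul]; abel
      rw [mem_closedBall, dist_eq_norm, e]
      have : ‖w + (c - 1) • u‖ ^ 2 ≤ r ^ 2 := by
        rw [norm_add_sq_real, real_inner_smul_right, hbu w', norm_smul, hu, Real.norm_eq_abs,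
          mul_one, sq_abs]
        nlinarith
      exact le_of_sq_le_sq this hr0.le
    · funext j
      change ⟪(b j : EuclideanSpace ℝ (Fin (m + 1))), w + c • u⟫ = z j
      rw [inner_add_right, real_inner_smul_right, hbu, hwz]
      ring
  have hvol : (μH[(m : ℝ)] : Measure (Fin m → ℝ)) (Icc (fun _ : Fin m => -ρ) (fun _ => ρ)) =
      ENNReal.ofReal ((r / (m + 1)) ^ m) := by
    have := hausdorffMeasure_pi_real (ι := Fin m)
    rw [Fintype.card_fin] at this
    rw [this, Real.volume_Icc_pi]
    simp only [Finset.prod_const, Finset.card_univ, Fintype.card_fin]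
    rw [← ENNReal.ofReal_pow (by linarith)]
    congr 2
    rw [hρ]
    field_simp
    ring
  rw [← hvol]
  refine (measure_mono hsub).trans ?_
  have := hF.hausdorffMeasure_image_le (Nat.cast_nonneg m)
    (sphere (0 : EuclideanSpace ℝ (Fin (m + 1))) 1 ∩ closedBall u r)
  simpa using this

lemma sphere_finite (m : ℕ) :
    μH[(m : ℝ)] (sphere (0 : EuclideanSpace ℝ (Fin (m + 1))) 1) < ⊤ := by
  let P : Fin (m + 1) → ℝ → (Fin m → ℝ) → EuclideanSpace ℝ (Fin (m + 1)) :=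
    fun i ε z => WithLp.toLp 2 (i.insertNth ε z)
  have hP : ∀ i ε, ContDiff ℝ 1 (P i ε) := by
    intro i ε
    rw [contDiff_euclidean]
    intro j
    refine Fin.succAboveCases i ?_ (fun k => ?_) j
    · simp only [P, Fin.insertNth_apply_same]
      exact contDiff_const
    · simp only [P, Fin.insertNth_apply_succAbove]
      exact contDiff_apply ℝ ℝ k
  have hP0 : ∀ i ε z, ε ≠ 0 → P i ε z ≠ 0 := by
    intro i ε z hε h
    have : P i ε z i = 0 := by rw [h]; rfl
    simp [P] at this
    exact hε this
  let G : Fin (m + 1) → ℝ → (Fin m → ℝ) → EuclideanSpace ℝ (Fin (m + 1)) :=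
    fun i ε z => ‖P i ε z‖⁻¹ • P i ε z
  have hG : ∀ i ε, ε ≠ 0 → ContDiff ℝ 1 (G i ε) := by
    intro i ε hε
    exact (((hP i ε).norm ℝ (fun z => hP0 i ε z hε)).inv
      (fun z => norm_ne_zero_iff.2 (hP0 i ε z hε))).smul (hP i ε)
  let B : Set (Fin m → ℝ) := closedBall 0 1
  have hfin : ∀ i ε, ε ≠ 0 → μH[(m : ℝ)] (G i ε '' B) < ⊤ := by
    intro i ε hε
    obtain ⟨K, hK⟩ := LocallyLipschitzOn.exists_lipschitzOnWith_of_compact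
      (isCompact_closedBall (0 : Fin m → ℝ) 1) ((hG i ε hε).locallyLipschitz.locallyLipschitzOn)
    refine (hK.hausdorffMeasure_image_le (Nat.cast_nonneg m)).trans_lt ?_
    have := hausdorffMeasure_pi_real (ι := Fin m)
    rw [Fintype.card_fin] at this
    rw [this]
    exact ENNReal.mul_lt_top (by simp) (isCompact_closedBall (0 : Fin m → ℝ) 1).measure_lt_top
  have hcov : sphere (0 : EuclideanSpace ℝ (Fin (m + 1))) 1 ⊆
      ⋃ i, (G i 1 '' B ∪ G i (-1) '' B) := by
    intro θ hθ
    have hθ1 : ‖θ‖ = 1 := by simpa using hθ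
    obtain ⟨i, -, hi⟩ := Finset.exists_max_image Finset.univ (fun i => |θ i|)
      Finset.univ_nonempty
    have hi0 : θ i ≠ 0 := by
      intro h0
      have : θ = 0 := by
        ext j
        have := hi j (Finset.mem_univ j)
        simp only [h0, abs_zero] at this
        simpa using abs_nonpos_iff.1 this
      simp [this] at hθ1
    have hipos : 0 < |θ i| := abs_pos.2 hi0
    let z : Fin m → ℝ := fun k => θ (i.succAbove k) / |θ i|
    have hz : z ∈ B := by
      simp only [B, mem_closedBall_zero_iff]
      rw [pi_norm_le_iff_of_nonneg zero_le_one]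
      intro k
      simp only [z, norm_div, Real.norm_eq_abs, abs_abs]
      exact div_le_one_of_le₀ (hi _ (Finset.mem_univ _)) (abs_nonneg _)
    have hPe : P i (θ i / |θ i|) z = |θ i|⁻¹ • θ := by
      ext j
      refine Fin.succAboveCases i ?_ (fun k => ?_) j
      · simp [P, div_eq_inv_mul]
      · simp [P, z, div_eq_inv_mul]
    have hGe : G i (θ i / |θ i|) z = θ := by
      simp only [G, hPe, norm_smul, hθ1, norm_inv, Real.norm_eq_abs, abs_abs, mul_one, inv_inv]
      rw [smul_smul, mul_inv_cancel₀ hipos.ne', one_smul]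
    refine mem_iUnion.2 ⟨i, ?_⟩
    rcases lt_or_gt_of_ne hi0 with h | h
    · right
      refine ⟨z, hz, ?_⟩
      rw [abs_of_neg h, div_neg, div_self hi0] at hGe
      exact hGe
    · left
      refine ⟨z, hz, ?_⟩
      rw [abs_of_pos h, div_self hi0] at hGe
      exact hGe
  refine (measure_mono hcov).trans_lt ?_
  refine (measure_iUnion_le _).trans_lt ?_
  rw [tsum_fintype]
  refine ENNReal.sum_lt_top.2 fun i _ => ?_
  refine (measure_union_le _ _).trans_lt ?_
  exact ENNReal.add_lt_top.2 ⟨hfin i 1 one_ne_zero, hfin i (-1) (by norm_num)⟩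

lemma suppFn_continuous {n : ℕ} {C : Set (EuclideanSpace ℝ (Fin n))} (hC : IsCompact C) :
    Continuous (suppFn C) := by
  unfold suppFn
  refine hC.continuous_sSup (f := fun x y => ⟪x, y⟫) ?_
  exact continuous_inner

lemma le_suppFn {n : ℕ} {C : Set (EuclideanSpace ℝ (Fin n))} (hC : IsCompact C)
    {y : EuclideanSpace ℝ (Fin n)} (hy : y ∈ C) (θ : EuclideanSpace ℝ (Fin n)) :
    ⟪θ, y⟫ ≤ suppFn C θ := by
  refine le_csSup ?_ (mem_image_of_mem _ hy)
  exact (hC.image (by fun_prop)).bddAbove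

lemma suppFn_le {n : ℕ} {C : Set (EuclideanSpace ℝ (Fin n))} (hC : C.Nonempty)
    {θ : EuclideanSpace ℝ (Fin n)} {B : ℝ} (h : ∀ y ∈ C, ⟪θ, y⟫ ≤ B) : suppFn C θ ≤ B := by
  refine csSup_le (hC.image _) ?_
  rintro _ ⟨y, hy, rfl⟩
  exact h y hy

/-- Pointwise lower bound for the difference of the support functions on a cap. -/
lemma suppFn_gap {n : ℕ} {K₁ K₂ : Set (EuclideanSpace ℝ (Fin n))} {D h : ℝ}
    {p : EuclideanSpace ℝ (Fin n)}
    (hne : K₁.Nonempty) (hK₁ : IsCompact K₁) (hc : Convex ℝ K₁) (hK₂ : IsCompact K₂)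
    (hsub : K₁ ⊆ K₂) (hD : Metric.diam K₂ ≤ D) (hp : p ∈ K₂) (hh : infDist p K₁ = h)
    (h0 : 0 < h) :
    h ≤ D ∧ ∃ u : EuclideanSpace ℝ (Fin n), ‖u‖ = 1 ∧
      ∀ θ ∈ closedBall u (h / (4 * D)), h / 2 ≤ suppFn K₂ θ - suppFn K₁ θ := by
  obtain ⟨q, hq, hqd⟩ := hK₁.exists_infDist_eq_dist hne p
  have hpq : ‖p - q‖ = h := by rw [← dist_eq_norm, ← hqd, hh]
  have hdist : ∀ y ∈ K₂, ∀ z ∈ K₂, ‖y - z‖ ≤ D := fun y hy z hz => by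
    rw [← dist_eq_norm]
    exact (Metric.dist_le_diam_of_mem hK₂.isBounded hy hz).trans hD
  have hhD : h ≤ D := hpq ▸ hdist p hp q (hsub hq)
  have hD0 : 0 < D := h0.trans_le hhD
  have hobt : ∀ y ∈ K₁, ⟪p - q, y - q⟫ ≤ 0 := by
    refine (norm_eq_iInf_iff_real_inner_le_zero hc hq).1 ?_
    have : Nonempty K₁ := ⟨⟨q, hq⟩⟩
    refine le_antisymm (le_ciInf fun w => ?_)
      (ciInf_le ⟨0, by rintro _ ⟨w, rfl⟩; exact norm_nonneg _⟩ (⟨q, hq⟩ : K₁))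
    rw [hpq, ← hh, ← dist_eq_norm]
    exact infDist_le_dist_of_mem w.2
  refine ⟨hhD, h⁻¹ • (p - q), ?_, fun θ hθ => ?_⟩
  · rw [norm_smul, hpq, norm_inv, Real.norm_eq_abs, abs_of_pos h0, inv_mul_cancel₀ h0.ne']
  set u := h⁻¹ • (p - q) with hu
  have hθu : ‖θ - u‖ ≤ h / (4 * D) := by rw [← dist_eq_norm]; exact hθ
  have hr1 : ‖θ - u‖ ≤ 1 / 4 := hθu.trans (by
    rw [div_le_div_iff₀ (by positivity) (by norm_num)]
    linarith)
  have hrD : ‖θ - u‖ * D ≤ h / 4 := by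
    have := mul_le_mul_of_nonneg_right hθu hD0.le
    refine this.trans (le_of_eq ?_)
    field_simp
  have h1 : 3 / 4 * h ≤ ⟪θ, p - q⟫ := by
    have e : ⟪θ, p - q⟫ = ⟪u, p - q⟫ + ⟪θ - u, p - q⟫ := by rw [inner_sub_left]; ring
    have e2 : ⟪u, p - q⟫ = h := by
      rw [hu, real_inner_smul_left, real_inner_self_eq_norm_sq, hpq]
      field_simp
    have e3 := (abs_le.1 (abs_real_inner_le_norm (θ - u) (p - q))).1
    rw [hpq] at e3
    have := mul_le_mul_of_nonneg_right hr1 h0.le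
    linarith
  have h2 : ∀ y ∈ K₁, ⟪θ, y - q⟫ ≤ h / 4 := by
    intro y hy
    have e : ⟪θ, y - q⟫ = ⟪u, y - q⟫ + ⟪θ - u, y - q⟫ := by
      rw [inner_sub_left θ u]; ring
    have e2 : ⟪u, y - q⟫ ≤ 0 := by
      rw [hu, real_inner_smul_left]
      exact mul_nonpos_of_nonneg_of_nonpos (by positivity) (hobt y hy)
    have e3 := real_inner_le_norm (θ - u) (y - q)
    have e4 := mul_le_mul_of_nonneg_left (hdist y (hsub hy) q (hsub hq)) (norm_nonneg (θ - u))
    linarith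
  have h3 : suppFn K₁ θ ≤ ⟪θ, p⟫ - h / 2 := by
    refine suppFn_le hne fun y hy => ?_
    have := h2 y hy
    rw [inner_sub_right] at this h1
    linarith
  have h4 := le_suppFn hK₂ hp θ
  linarith

lemma meanWidth_gap (m : ℕ) (D : ℝ) (hD0 : 0 < D) :
    ∃ κ : ℝ, 0 < κ ∧ ∀ (K₁ K₂ : Set (EuclideanSpace ℝ (Fin (m + 1))))
      (p : EuclideanSpace ℝ (Fin (m + 1))) (h : ℝ),
      K₁.Nonempty → IsCompact K₁ → Convex ℝ K₁ → IsCompact K₂ → K₁ ⊆ K₂ →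
      Metric.diam K₂ ≤ D → p ∈ K₂ → infDist p K₁ = h → 0 < h →
      κ * h ^ (m + 1) ≤ meanWidth K₂ - meanWidth K₁ := by
  have hμ : sphereMeasure (m + 1) = μH[(m : ℝ)] := by
    unfold sphereMeasure
    congr 1
    push_cast
    ring
  have hfin := sphere_finite m
  have hA : 0 < sphereArea (m + 1) := by
    unfold sphereArea
    rw [hμ]
    refine ENNReal.toReal_pos ?_ hfin.ne
    have h1 := cap_measure (EuclideanSpace.single (0 : Fin (m + 1)) (1 : ℝ)) (by simp) 1
      one_pos le_rfl
    have h2 := h1.trans (measure_mono inter_subset_left)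
    refine (lt_of_lt_of_le ?_ h2).ne'
    rw [ENNReal.ofReal_pos]
    positivity
  refine ⟨(2 / sphereArea (m + 1)) * (1 / 2 * (1 / (4 * D * (m + 1))) ^ m), by positivity, ?_⟩
  intro K₁ K₂ p h hne hK₁ hc hK₂ hsub hD hp hh h0
  obtain ⟨hhD, u, hu, hgap⟩ := suppFn_gap hne hK₁ hc hK₂ hsub hD hp hh h0
  unfold meanWidth
  rw [hμ]
  set S := sphere (0 : EuclideanSpace ℝ (Fin (m + 1))) 1 with hS
  set μ : Measure (EuclideanSpace ℝ (Fin (m + 1))) := μH[(m : ℝ)] with hμdef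
  have hint : ∀ C : Set (EuclideanSpace ℝ (Fin (m + 1))), IsCompact C →
      IntegrableOn (suppFn C) S μ := by
    intro C hC
    exact (suppFn_continuous hC).continuousOn.integrableOn_of_subset_isCompact
      (isCompact_sphere _ _) isClosed_sphere.measurableSet subset_rfl hfin.ne
  rw [← mul_sub, ← integral_sub (hint K₂ hK₂) (hint K₁ hK₁), mul_assoc]
  refine mul_le_mul_of_nonneg_left ?_ (by positivity)
  set T := S ∩ closedBall u (h / (4 * D)) with hT
  have hTm : MeasurableSet T := (isClosed_sphere.inter isClosed_closedBall).measurableSet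
  have hTfin : μ T ≠ ⊤ := ((measure_mono inter_subset_left).trans_lt hfin).ne
  have hd := (hint K₂ hK₂).sub (hint K₁ hK₁)
  have h1 : ∫ θ in T, (suppFn K₂ θ - suppFn K₁ θ) ∂μ ≤
      ∫ θ in S, (suppFn K₂ θ - suppFn K₁ θ) ∂μ := by
    refine setIntegral_mono_set hd ?_ (Filter.Eventually.of_forall inter_subset_left)
    refine Filter.Eventually.of_forall fun θ => ?_
    simp only [Pi.zero_apply, sub_nonneg]
    exact suppFn_le hne fun y hy => le_suppFn hK₂ (hsub hy) θ
  have h2 : h / 2 * μ.real T ≤ ∫ θ in T, (suppFn K₂ θ - suppFn K₁ θ) ∂μ := by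
    exact setIntegral_ge_of_const_le_real hTm hTfin (fun θ hθ => hgap θ hθ.2)
      (hd.mono_set inter_subset_left)
  have h3 : (h / (4 * D) / (m + 1)) ^ m ≤ μ.real T := by
    have := cap_measure u hu (h / (4 * D)) (by positivity)
      ((div_le_one (by positivity)).2 (by linarith))
    exact (ENNReal.ofReal_le_iff_le_toReal hTfin).1 this
  refine le_trans ?_ (h2.trans h1)
  refine le_trans (le_of_eq ?_) (mul_le_mul_of_nonneg_left h3 (by positivity))
  have : h / (4 * D) / (m + 1) = h * (1 / (4 * D * (m + 1))) := by field_simp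
  rw [this, mul_pow, pow_succ]
  ring

/-- length bounds for expanding couples with a two-element stratification. -/
theorem expandingCouple_length_bounds (n : ℕ) (hn : 2 ≤ n) :
    (∃ c : ℝ, 0 < c ∧
      ∀ (K₁ K₂ : Set (EuclideanSpace ℝ (Fin n))) (a b : ℝ)
        (x : ℝ → EuclideanSpace ℝ (Fin n)),
        K₁.Nonempty → IsCompact K₁ → Convex ℝ K₁ →
        K₂.Nonempty → IsCompact K₂ → Convex ℝ K₂ → K₁ ⊆ K₂ →
        SelfExpanding a b x →
        (∀ t ∈ Icc a b, x t ∈ K₂) →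
        (∃ s ∈ Icc a b, x s ∈ K₁) →
        (∃ s ∈ Icc a b, x s ∈ intrinsicFrontier ℝ K₂) →
        (∀ Q ∈ ({K₁, K₂} : Set (Set (EuclideanSpace ℝ (Fin n)))), ∀ y ∈ Q,
          ∀ s s', a ≤ s → s ≤ s' → s' ≤ b → x s ∉ intrinsicInterior ℝ Q →
            dist (x s) y ≤ dist (x s') y) →
        eVariationOn x {t | t ∈ Icc a b ∧ x t ∉ K₁} ≤
          ENNReal.ofReal (2 * c * hausdorffDist K₁ K₂)) ∧
    (∀ D : ℝ, 0 < D → ∃ c : ℝ, 0 < c ∧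
      ∀ (K₁ K₂ : Set (EuclideanSpace ℝ (Fin n))) (a b : ℝ)
        (x : ℝ → EuclideanSpace ℝ (Fin n)),
        K₁.Nonempty → IsCompact K₁ → Convex ℝ K₁ →
        K₂.Nonempty → IsCompact K₂ → Convex ℝ K₂ → K₁ ⊆ K₂ →
        Metric.diam K₂ ≤ D →
        SelfExpanding a b x →
        (∀ t ∈ Icc a b, x t ∈ K₂) →
        (∃ s ∈ Icc a b, x s ∈ K₁) →
        (∃ s ∈ Icc a b, x s ∈ intrinsicFrontier ℝ K₂) →
        (∀ Q ∈ ({K₁, K₂} : Set (Set (EuclideanSpace ℝ (Fin n)))), ∀ y ∈ Q,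
          ∀ s s', a ≤ s → s ≤ s' → s' ≤ b → x s ∉ intrinsicInterior ℝ Q →
            dist (x s) y ≤ dist (x s') y) →
        eVariationOn x {t | t ∈ Icc a b ∧ x t ∉ K₁} ≤
          ENNReal.ofReal (c * (meanWidth K₂ - meanWidth K₁) ^ ((1 : ℝ) / n))) := by
  obtain ⟨C, hC, hvar⟩ := couple_variation (EuclideanSpace ℝ (Fin n))
  refine ⟨⟨C, hC, ?_⟩, ?_⟩
  · intro K₁ K₂ a b x hne₁ hK₁ _ hne₂ hK₂ _ _ hx hxK _ _ hQ
    refine hvar K₁ a b _ x hne₁ hK₁ hx.2 (fun y hy => hQ K₁ (by simp) y hy) fun t ht => ?_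
    rw [hausdorffDist_comm]
    exact infDist_le_hausdorffDist_of_mem (hxK t ht)
      (hausdorffEDist_ne_top_of_nonempty_of_bounded hne₂ hne₁ hK₂.isBounded hK₁.isBounded)
  · intro D hD
    obtain ⟨m, rfl⟩ : ∃ m, n = m + 1 := ⟨n - 1, by omega⟩
    obtain ⟨κ, hκ, hgap⟩ := meanWidth_gap m D hD
    have hκ' : 0 < κ ^ ((1 : ℝ) / ((m + 1 : ℕ) : ℝ)) := Real.rpow_pos_of_pos hκ _
    refine ⟨2 * C / κ ^ ((1 : ℝ) / ((m + 1 : ℕ) : ℝ)), by positivity, ?_⟩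
    intro K₁ K₂ a b x hne₁ hK₁ hc₁ hne₂ hK₂ _ hsub hdiam hx hxK _ _ hQ
    obtain ⟨p, hp, hmax⟩ := hK₂.exists_isMaxOn hne₂
      (continuous_infDist_pt K₁).continuousOn
    have hv := hvar K₁ a b (infDist p K₁) x hne₁ hK₁ hx.2
      (fun y hy => hQ K₁ (by simp) y hy) (fun t ht => hmax (hxK t ht))
    rcases (infDist_nonneg : 0 ≤ infDist p K₁).eq_or_lt with h0 | h0
    · rw [← h0, mul_zero, ENNReal.ofReal_zero] at hv
      exact hv.trans zero_le
    · refine hv.trans (ENNReal.ofReal_le_ofReal ?_)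
      have hg := hgap K₁ K₂ p _ hne₁ hK₁ hc₁ hK₂ hsub hdiam hp rfl h0
      have h1 := Real.rpow_le_rpow (by positivity) hg
        (show (0 : ℝ) ≤ (1 : ℝ) / ((m + 1 : ℕ) : ℝ) by positivity)
      rw [Real.mul_rpow hκ.le (by positivity), one_div,
        Real.pow_rpow_inv_natCast h0.le (Nat.succ_ne_zero m), ← one_div] at h1
      rw [div_mul_eq_mul_div, le_div_iff₀ hκ']
      have := mul_le_mul_of_nonneg_left h1 (show 0 ≤ 2 * C by positivity)
      linarith

end
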